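/- Let b = 0 and a < 0. Then with positive probability the walk driven by D^{a,b} eventually visits only three consecutive sites (i.e. gets stuck on a set of two edges): with positive probability there exist x ∈ ℤ and n₀ ≥ 0 such that X_n ∈ {x, x+1, x+2} for all n ≥ n₀. -/

import Mathlib

open MeasureTheory Real Filter Set

noncomputable section

/-- Number of crossings of the edge `{e, e+1}` (i.e. the half-integer edge `e + 1/2`)
before time `n`. -/
def locTime {Ω : Type*} (X : ℕ → Ω → ℤ) (n : ℕ) (e : ℤ) (ω : Ω) : ℕ :=
  ((Finset.range n).filter fun m => min (X m ω) (X (m + 1) ω) = e).card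

/-- Local time profile seen from the walker: `ℓ_n(k + 1/2)`. -/
def shiftedProfile {Ω : Type*} (X : ℕ → Ω → ℤ) (n : ℕ) (k : ℤ) (ω : Ω) : ℕ :=
  locTime X n (X n ω + k) ω

/-- `F(y) = e^y / (e^y + e^{-y})`. -/
def walkF (y : ℝ) : ℝ := Real.exp y / (Real.exp y + Real.exp (-y))

/-- The σ-algebra generated by `X_0, …, X_n`. -/
def walkFiltration {Ω : Type*} (X : ℕ → Ω → ℤ) (n : ℕ) : MeasurableSpace Ω :=
  ⨆ m ∈ Finset.range (n + 1), MeasurableSpace.comap (X m) inferInstance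

/-- The drift `D^{a,b}(ℓ_n) = a ℓ_n(-3/2) + b ℓ_n(-1/2) - b ℓ_n(1/2) - a ℓ_n(3/2)`,
with the half-integer edge `k + 1/2` encoded by the integer `k`. -/
def Dab {Ω : Type*} (a b : ℝ) (X : ℕ → Ω → ℤ) (n : ℕ) (ω : Ω) : ℝ :=
  a * shiftedProfile X n (-2) ω + b * shiftedProfile X n (-1) ω
    - b * shiftedProfile X n 0 ω - a * shiftedProfile X n 1 ω

lemma one_sub_walkF (y : ℝ) : 1 - walkF y = 1 / (1 + exp (2 * y)) := by
  have h : exp (2 * y) = exp y / exp (-y) := by rw [← exp_sub]; ring_nf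
  have := exp_pos y
  have := exp_pos (-y)
  rw [walkF, h]
  field_simp
  ring

lemma walkF_neg (y : ℝ) : walkF (-y) = 1 - walkF y := by
  have := exp_pos y
  have := exp_pos (-y)
  rw [walkF, walkF, neg_neg]
  field_simp
  ring

/-- Lower bound for the probability of staying in `{-1, 0, 1}` forever, seen from the middle site
when the edges `{-1, 0}` and `{0, 1}` have local times `l` and `r`; here `t = e^{2a}`. -/
def stayWeight (t : ℝ) (l r : ℕ) : ℝ := exp (-((t ^ l + t ^ r) / (1 - t ^ 2)))

/-- The extension of `stayWeight` to all sites, making it subharmonic for the walk. -/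
def stayPotential (t : ℝ) (x : ℤ) (l r : ℕ) : ℝ :=
  if x = 0 then stayWeight t l r
  else if x = 1 then 1 / (1 + t ^ l) * stayWeight t l (r + 1)
  else if x = -1 then 1 / (1 + t ^ r) * stayWeight t (l + 1) r
  else 0

lemma stayWeight_le_one {t : ℝ} (h0 : 0 < t) (h1 : t < 1) (l r : ℕ) : stayWeight t l r ≤ 1 := by
  have : 0 < 1 - t ^ 2 := by nlinarith
  exact exp_le_one_iff.2 (by rw [neg_nonpos]; positivity)

lemma stayWeight_comm (t : ℝ) (l r : ℕ) : stayWeight t l r = stayWeight t r l := by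
  rw [stayWeight, stayWeight, add_comm]

lemma stayWeight_add_two {t : ℝ} (h0 : 0 < t) (h1 : t < 1) (l r : ℕ) :
    (1 + t ^ r) * stayWeight t l r ≤ stayWeight t l (r + 2) := by
  have h2 : 1 - t ^ 2 ≠ 0 := by nlinarith
  have h : stayWeight t l (r + 2) = exp (t ^ r) * stayWeight t l r := by
    rw [stayWeight, stayWeight, ← exp_add]
    congr 1
    field_simp
    ring
  rw [h]
  have := add_one_le_exp (t ^ r)
  exact mul_le_mul_of_nonneg_right (by linarith) (exp_pos _).le

lemma stayPotential_nonneg {t : ℝ} (h0 : 0 < t) (x : ℤ) (l r : ℕ) :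
    0 ≤ stayPotential t x l r := by
  unfold stayPotential stayWeight
  split_ifs <;> positivity

lemma stayPotential_le_one {t : ℝ} (h0 : 0 < t) (h1 : t < 1) (x : ℤ) (l r : ℕ) :
    stayPotential t x l r ≤ 1 := by
  have hq (k : ℕ) : 1 / (1 + t ^ k) ≤ 1 := by
    have : 0 < t ^ k := by positivity
    rw [div_le_one (by positivity)]
    linarith
  have hw (l r : ℕ) : 0 ≤ stayWeight t l r := (exp_pos _).le
  unfold stayPotential
  split_ifs
  · exact stayWeight_le_one h0 h1 _ _
  · exact mul_le_one₀ (hq _) (hw _ _) (stayWeight_le_one h0 h1 _ _)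
  · exact mul_le_one₀ (hq _) (hw _ _) (stayWeight_le_one h0 h1 _ _)
  · exact zero_le_one

lemma stayWeight_le_average {t : ℝ} (h0 : 0 < t) (h1 : t < 1) (l r : ℕ) :
    stayWeight t l r ≤ 1 / 2 * (1 / (1 + t ^ l) * stayWeight t l (r + 2))
      + 1 / 2 * (1 / (1 + t ^ r) * stayWeight t (l + 2) r) := by
  have hA := stayWeight_add_two h0 h1 l r
  have hB := stayWeight_add_two h0 h1 r l
  rw [stayWeight_comm t r l, stayWeight_comm t r (l + 2)] at hB
  have hw : 0 < stayWeight t l r := exp_pos _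
  have hl : 0 < 1 + t ^ l := by positivity
  have hr : 0 < 1 + t ^ r := by positivity
  generalize 1 + t ^ l = p at *
  generalize 1 + t ^ r = q at *
  generalize stayWeight t l r = w at *
  have key : w ≤ 1 / 2 * (1 / p * (q * w)) + 1 / 2 * (1 / q * (p * w)) := by
    have : 1 / 2 * (1 / p * (q * w)) + 1 / 2 * (1 / q * (p * w)) - w
        = w * (p - q) ^ 2 / (2 * p * q) := by
      field_simp
      ring
    have : 0 ≤ w * (p - q) ^ 2 / (2 * p * q) := by positivity
    linarith
  refine key.trans ?_
  gcongr

/-- The value of the potential after a step of the walk to the right. -/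
def potentialRight (t : ℝ) (x : ℤ) (l r : ℕ) : ℝ :=
  stayPotential t (x + 1) (l + if x = -1 then 1 else 0) (r + if x = 0 then 1 else 0)

/-- The value of the potential after a step of the walk to the left. -/
def potentialLeft (t : ℝ) (x : ℤ) (l r : ℕ) : ℝ :=
  stayPotential t (x - 1) (l + if x = 0 then 1 else 0) (r + if x = 1 then 1 else 0)

/-- The drift of the walk when only the edges `{-1, 0}` and `{0, 1}` have been crossed. -/
def innerDrift (a : ℝ) (x : ℤ) (l r : ℕ) : ℝ :=
  if x = 1 then a * l else if x = -1 then -(a * r) else 0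

lemma stayPotential_le_step {a : ℝ} (ha : a < 0) {x : ℤ} (hx : |x| ≤ 1) (l r : ℕ) :
    stayPotential (exp (2 * a)) x l r ≤
      walkF (innerDrift a x l r)
          * (potentialRight (exp (2 * a)) x l r - potentialLeft (exp (2 * a)) x l r)
        + potentialLeft (exp (2 * a)) x l r := by
  have h1 : exp (2 * a) < 1 := exp_lt_one_iff.2 (by linarith)
  have hF (k : ℕ) : 1 - walkF (a * k) = 1 / (1 + exp (2 * a) ^ k) := by
    rw [one_sub_walkF, ← exp_nat_mul]
    ring_nf
  have hF0 : walkF 0 = 1 / 2 := by norm_num [walkF]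
  obtain ⟨h, h'⟩ := abs_le.1 hx
  interval_cases x
  · have := hF r
    simp only [stayPotential, potentialRight, potentialLeft, innerDrift]
    norm_num
    rw [walkF_neg, this, one_div]
  · have := stayWeight_le_average (exp_pos (2 * a)) h1 l r
    simp only [stayPotential, potentialRight, potentialLeft, innerDrift]
    norm_num [hF0] at this ⊢
    linarith
  · have := hF l
    simp only [stayPotential, potentialRight, potentialLeft, innerDrift]
    norm_num
    rw [one_div] at this
    rw [← this]
    linarith

section Walk

variable {Ω : Type*} {X : ℕ → Ω → ℤ}

lemma locTime_succ (n : ℕ) (e : ℤ) (ω : Ω) :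
    locTime X (n + 1) e ω =
      locTime X n e ω + if min (X n ω) (X (n + 1) ω) = e then 1 else 0 := by
  rw [locTime, locTime, Finset.range_add_one, Finset.filter_insert]
  split_ifs
  · rw [Finset.card_insert_of_notMem (by simp)]
  · rfl

/-- The event that the walk stays in `{-1, 0, 1}` up to time `n`. -/
def staySet (X : ℕ → Ω → ℤ) (n : ℕ) : Set Ω := {ω | ∀ m ≤ n, |X m ω| ≤ 1}

lemma locTime_eq_zero {n : ℕ} {ω : Ω} (hω : ω ∈ staySet X n)
    (hs : ∀ m, |X (m + 1) ω - X m ω| = 1) {e : ℤ} (he : e ≠ -1) (he' : e ≠ 0) :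
    locTime X n e ω = 0 := by
  rw [locTime, Finset.card_eq_zero, Finset.filter_eq_empty_iff]
  intro m hm
  rw [Finset.mem_range] at hm
  have h1 := abs_le.1 (hω m hm.le)
  have h2 := abs_le.1 (hω (m + 1) hm)
  rcases (abs_eq zero_le_one).1 (hs m) with h | h <;> omega

lemma Dab_eq_innerDrift (a : ℝ) {n : ℕ} {ω : Ω} (hω : ω ∈ staySet X n)
    (hs : ∀ m, |X (m + 1) ω - X m ω| = 1) :
    Dab a 0 X n ω = innerDrift a (X n ω) (locTime X n (-1) ω) (locTime X n 0 ω) := by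
  obtain ⟨h, h'⟩ := abs_le.1 (hω n le_rfl)
  have hz {e : ℤ} (he : e ≠ -1) (he' : e ≠ 0) := locTime_eq_zero hω hs he he'
  simp only [Dab, shiftedProfile, innerDrift]
  generalize X n ω = x at *
  interval_cases x
  · norm_num [hz (e := -3)]
  · norm_num [hz (e := -2), hz (e := 1)]
  · norm_num [hz (e := 2)]

lemma measurable_locTime {m : MeasurableSpace Ω} {n : ℕ} (hX : ∀ k ≤ n, Measurable (X k)) (e : ℤ) :
    Measurable (locTime X n e) := by
  have h : locTime X n e =
      fun ω => ∑ k ∈ Finset.range n, if min (X k ω) (X (k + 1) ω) = e then 1 else 0 := by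
    ext ω
    rw [locTime, Finset.card_filter]
  rw [h]
  refine Finset.measurable_sum _ fun k hk => ?_
  rw [Finset.mem_range] at hk
  exact Measurable.ite (((hX k hk.le).min (hX (k + 1) hk)) (measurableSet_singleton e))
    measurable_const measurable_const

lemma measurableSet_staySet {m : MeasurableSpace Ω} {n : ℕ} (hX : ∀ k ≤ n, Measurable (X k)) :
    MeasurableSet (staySet X n) := by
  have h : staySet X n = ⋂ k, ⋂ (_ : k ≤ n), X k ⁻¹' {x | |x| ≤ 1} := by
    ext ω
    simp [staySet]
  rw [h]
  exact MeasurableSet.iInter fun k => MeasurableSet.iInter fun hk => hX k hk .of_discrete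

/-- A function of the position and of the local times of `{-1, 0}` and `{0, 1}`, restricted to
the event that the walk has stayed in `{-1, 0, 1}`. -/
def stayProcess (f : ℤ → ℕ → ℕ → ℝ) (X : ℕ → Ω → ℤ) (n : ℕ) : Ω → ℝ :=
  (staySet X n).indicator fun ω => f (X n ω) (locTime X n (-1) ω) (locTime X n 0 ω)

lemma measurable_stayProcess {m : MeasurableSpace Ω} {n : ℕ} (hX : ∀ k ≤ n, Measurable (X k))
    (f : ℤ → ℕ → ℕ → ℝ) : Measurable (stayProcess f X n) := by
  have hf : Measurable fun p : ℤ × ℕ × ℕ => f p.1 p.2.1 p.2.2 := .of_discrete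
  exact (hf.comp ((hX n le_rfl).prodMk
    ((measurable_locTime hX _).prodMk (measurable_locTime hX _)))).indicator
      (measurableSet_staySet hX)

lemma stayProcess_mem_Icc {f : ℤ → ℕ → ℕ → ℝ} (hf : ∀ x l r, f x l r ∈ Icc 0 1) (n : ℕ) (ω : Ω) :
    stayProcess f X n ω ∈ Icc 0 1 := by
  by_cases h : ω ∈ staySet X n <;> simp only [stayProcess, h, indicator_of_mem, not_false_eq_true,
    indicator_of_notMem]
  · exact hf _ _ _
  · simp

lemma stayProcess_succ {t : ℝ} {n : ℕ} {ω : Ω} (hs : |X (n + 1) ω - X n ω| = 1) :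
    stayProcess (stayPotential t) X (n + 1) ω =
      (if X (n + 1) ω = X n ω + 1 then 1 else 0) *
          (stayProcess (potentialRight t) X n ω - stayProcess (potentialLeft t) X n ω)
        + stayProcess (potentialLeft t) X n ω := by
  have hsub : ω ∈ staySet X (n + 1) ↔ ω ∈ staySet X n ∧ |X (n + 1) ω| ≤ 1 := by
    simp only [staySet, mem_ofPred_eq, Nat.le_succ_iff, or_imp, forall_and, forall_eq]
  by_cases h : ω ∈ staySet X n
  swap
  · simp [stayProcess, h, hsub]
  have hv : stayProcess (stayPotential t) X (n + 1) ω = stayPotential t (X (n + 1) ω)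
      (locTime X (n + 1) (-1) ω) (locTime X (n + 1) 0 ω) := by
    by_cases h' : |X (n + 1) ω| ≤ 1
    · simp [stayProcess, h, h', hsub]
    · have : X (n + 1) ω ≠ 0 ∧ X (n + 1) ω ≠ 1 ∧ X (n + 1) ω ≠ -1 := by
        refine ⟨?_, ?_, ?_⟩ <;> intro h0 <;> simp [h0] at h'
      simp [stayProcess, h', hsub, stayPotential, this]
  rw [hv, locTime_succ, locTime_succ]
  simp only [stayProcess, h, indicator_of_mem, potentialRight, potentialLeft]
  rcases (abs_eq zero_le_one).1 hs with h1 | h1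
  · have e : X (n + 1) ω = X n ω + 1 := by omega
    simp [e]
  · have e : X (n + 1) ω = X n ω - 1 := by omega
    have e1 : ¬ X n ω - 1 = X n ω + 1 := by omega
    have e2 : X n ω - 1 = -1 ↔ X n ω = 0 := by omega
    have e3 : X n ω - 1 = 0 ↔ X n ω = 1 := by omega
    simp [e, e1, e2, e3]

end Walk

lemma integrable_of_mem_Icc {Ω : Type*} [MeasurableSpace Ω] {μ : Measure Ω} [IsFiniteMeasure μ]
    {f : Ω → ℝ} (hf : Measurable f) (h : ∀ ω, f ω ∈ Icc 0 1) : Integrable f μ :=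
  .of_bound hf.aestronglyMeasurable 1 <| .of_forall fun ω => by
    rw [norm_of_nonneg (h ω).1]
    exact (h ω).2

lemma integral_stayProcess_le_succ {Ω : Type*} [MeasurableSpace Ω] {μ : Measure Ω}
    [IsProbabilityMeasure μ] {X : ℕ → Ω → ℤ} (hmeas : ∀ n, Measurable (X n))
    (hstep : ∀ n, ∀ᵐ ω ∂μ, |X (n + 1) ω - X n ω| = 1) {a : ℝ} (ha : a < 0) (n : ℕ)
    (hdrive : μ[(fun ω => if X (n + 1) ω = X n ω + 1 then (1 : ℝ) else 0) | walkFiltration X n]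
        =ᵐ[μ] fun ω => walkF (Dab a 0 X n ω)) :
    ∫ ω, stayProcess (stayPotential (exp (2 * a))) X n ω ∂μ ≤
      ∫ ω, stayProcess (stayPotential (exp (2 * a))) X (n + 1) ω ∂μ := by
  set t := exp (2 * a)
  have h1 : t < 1 := exp_lt_one_iff.2 (by linarith)
  have hpot (x : ℤ) (l r : ℕ) : stayPotential t x l r ∈ Icc 0 1 :=
    ⟨stayPotential_nonneg (exp_pos _) _ _ _, stayPotential_le_one (exp_pos _) h1 _ _ _⟩
  have hle : walkFiltration X n ≤ ‹MeasurableSpace Ω› :=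
    iSup₂_le fun m _ => (hmeas m).comap_le
  have hadapt (k : ℕ) (hk : k ≤ n) : Measurable[walkFiltration X n] (X k) :=
    measurable_iff_comap_le.2 <|
      le_iSup₂_of_le (f := fun m (_ : m ∈ Finset.range (n + 1)) =>
        MeasurableSpace.comap (X m) inferInstance) k (Finset.mem_range.2 (by omega)) le_rfl
  set R : Ω → ℝ := fun ω => if X (n + 1) ω = X n ω + 1 then (1 : ℝ) else 0
  set G := stayProcess (potentialRight t) X n
  set H := stayProcess (potentialLeft t) X n
  have hR : Measurable R := Measurable.ite
    (measurableSet_eq_fun (hmeas (n + 1)) ((hmeas n).add_const 1)) measurable_const measurable_const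
  have hRi : Integrable R μ := integrable_of_mem_Icc hR fun ω => by
    simp only [R]
    split_ifs <;> simp
  have hGI (ω : Ω) : G ω ∈ Icc 0 1 := stayProcess_mem_Icc (fun _ _ _ => hpot _ _ _) n ω
  have hHI (ω : Ω) : H ω ∈ Icc 0 1 := stayProcess_mem_Icc (fun _ _ _ => hpot _ _ _) n ω
  have hG : Measurable[walkFiltration X n] G := measurable_stayProcess hadapt _
  have hH : Measurable[walkFiltration X n] H := measurable_stayProcess hadapt _
  have hHi : Integrable H μ := integrable_of_mem_Icc (hH.mono hle le_rfl) hHI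
  have hGH : StronglyMeasurable[walkFiltration X n] (G - H) := (hG.sub hH).stronglyMeasurable
  have hRGH : Integrable (R * (G - H)) μ :=
    hRi.mul_bdd (c := 1) (hGH.mono hle).aestronglyMeasurable <| .of_forall fun ω => by
      have := hGI ω
      have := hHI ω
      simp only [mem_Icc] at *
      rw [Pi.sub_apply, norm_eq_abs, abs_le]
      constructor <;> linarith
  have hce : μ[R * (G - H) | walkFiltration X n] =ᵐ[μ]
      fun ω => walkF (Dab a 0 X n ω) * (G ω - H ω) := by
    filter_upwards [condExp_mul_of_stronglyMeasurable_right hGH hRGH hRi, hdrive] with ω h h'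
    rw [h, Pi.mul_apply, h', Pi.sub_apply]
  have hint : ∫ ω, stayProcess (stayPotential t) X (n + 1) ω ∂μ =
      ∫ ω, walkF (Dab a 0 X n ω) * (G ω - H ω) + H ω ∂μ := by
    calc ∫ ω, stayProcess (stayPotential t) X (n + 1) ω ∂μ
        = ∫ ω, (R * (G - H)) ω + H ω ∂μ := by
          refine integral_congr_ae ?_
          filter_upwards [hstep n] with ω h using stayProcess_succ h
      _ = ∫ ω, (μ[R * (G - H) | walkFiltration X n]) ω + H ω ∂μ := by
          rw [integral_add hRGH hHi, integral_add integrable_condExp hHi, integral_condExp hle]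
      _ = _ := integral_congr_ae (by filter_upwards [hce] with ω h; rw [h])
  rw [hint]
  refine integral_mono_ae (integrable_of_mem_Icc
    (measurable_stayProcess (fun k _ => hmeas k) _) (stayProcess_mem_Icc hpot n))
    (((integrable_condExp (f := R * (G - H))).congr hce).add hHi) ?_
  filter_upwards [ae_all_iff.2 hstep] with ω hω
  by_cases h : ω ∈ staySet X n
  · rw [Dab_eq_innerDrift a h hω]
    simpa only [G, H, stayProcess, h, indicator_of_mem] using
      stayPotential_le_step ha (h n le_rfl) _ _
  · simp [G, H, stayProcess, h]

/-- if `b = 0` and `a < 0`, then with positive probability the walk driven by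
`D^{a,b}` eventually visits only three consecutive sites. -/
theorem stmt4 {Ω : Type*} [MeasurableSpace Ω] (μ : Measure Ω) [IsProbabilityMeasure μ]
    (X : ℕ → Ω → ℤ) (hmeas : ∀ n, Measurable (X n))
    (hX0 : ∀ᵐ ω ∂μ, X 0 ω = 0)
    (hstep : ∀ n, ∀ᵐ ω ∂μ, |X (n + 1) ω - X n ω| = 1)
    (a : ℝ) (ha : a < 0)
    (hdrive : ∀ n,
      μ[(fun ω => if X (n + 1) ω = X n ω + 1 then (1 : ℝ) else 0) | walkFiltration X n]
        =ᵐ[μ] fun ω => walkF (Dab a 0 X n ω)) :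
    0 < μ {ω | ∃ x : ℤ, ∃ n₀ : ℕ, ∀ n ≥ n₀,
        X n ω = x ∨ X n ω = x + 1 ∨ X n ω = x + 2} := by
  set t := exp (2 * a)
  have h1 : t < 1 := exp_lt_one_iff.2 (by linarith)
  have hpot (x : ℤ) (l r : ℕ) : stayPotential t x l r ∈ Icc 0 1 :=
    ⟨stayPotential_nonneg (exp_pos _) _ _ _, stayPotential_le_one (exp_pos _) h1 _ _ _⟩
  have hmono : Monotone fun n => ∫ ω, stayProcess (stayPotential t) X n ω ∂μ :=
    monotone_nat_of_le_succ fun n => integral_stayProcess_le_succ hmeas hstep ha n (hdrive n)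
  have hinit : ∫ ω, stayProcess (stayPotential t) X 0 ω ∂μ = stayWeight t 0 0 := by
    have : stayProcess (stayPotential t) X 0 =ᵐ[μ] fun _ => stayWeight t 0 0 := by
      filter_upwards [hX0] with ω h
      have : ω ∈ staySet X 0 := by simp [staySet, h]
      simp [stayProcess, this, h, stayPotential, locTime]
    rw [integral_congr_ae this]
    simp
  have hA (n : ℕ) : MeasurableSet (staySet X n) := measurableSet_staySet fun k _ => hmeas k
  have hbound (n : ℕ) : ENNReal.ofReal (stayWeight t 0 0) ≤ μ (staySet X n) := by
    rw [← hinit, ← ofReal_measureReal, ← integral_indicator_one (hA n)]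
    refine ENNReal.ofReal_le_ofReal ((hmono n.zero_le).trans (integral_mono
      (integrable_of_mem_Icc (measurable_stayProcess (fun k _ => hmeas k) _)
        (stayProcess_mem_Icc hpot n))
      ((integrable_const (1 : ℝ)).indicator (hA n)) fun ω => ?_))
    exact indicator_le_indicator (hpot _ _ _).2
  have hanti : Antitone (staySet X) := fun m n hmn ω hω k hk => hω k (hk.trans hmn)
  have hlim := tendsto_measure_iInter_atTop (μ := μ) (fun n => (hA n).nullMeasurableSet) hanti
    ⟨0, measure_ne_top _ _⟩
  refine (ENNReal.ofReal_pos.2 (exp_pos _)).trans_le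
    ((ge_of_tendsto' hlim hbound).trans (measure_mono fun ω hω => ⟨-1, 0, fun n _ => ?_⟩))
  have := abs_le.1 (mem_iInter.1 hω n n le_rfl)
  omega
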